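/- Let f : ℝⁿ → [0,1] be continuously differentiable with bounded derivative. Then the reverse Bobkov inequality holds: |∫_{ℝⁿ} ∇f dγₙ|² + (∫_{ℝⁿ} I_γ(f) dγₙ)² ≤ I_γ(∫_{ℝⁿ} f dγₙ)², where ∫ ∇f dγₙ is the vector of coordinatewise integrals. -/

import Mathlib

open MeasureTheory

/-- Standard Gaussian density `φ` on `ℝ`. -/
noncomputable def gaussPdf (x : ℝ) : ℝ := (Real.sqrt (2 * Real.pi))⁻¹ * Real.exp (-(x ^ 2) / 2)

/-- Standard Gaussian cumulative distribution function `Φ`. -/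
noncomputable def gaussCdf (x : ℝ) : ℝ := ∫ t in Set.Iic x, gaussPdf t

/-- Inverse of the Gaussian cdf (quantile function `Φ⁻¹`). -/
noncomputable def gaussQuantile : ℝ → ℝ := Function.invFun gaussCdf

/-- Gaussian isoperimetric profile `I_γ`: `I_γ(v) = φ(Φ⁻¹(v))` on `(0,1)`, `0` at the endpoints. -/
noncomputable def Igauss (v : ℝ) : ℝ :=
  if v = 0 ∨ v = 1 then 0 else gaussPdf (gaussQuantile v)

abbrev En (n : ℕ) := EuclideanSpace ℝ (Fin n)

/-- Standard Gaussian probability measure `γₙ` on `ℝⁿ`. -/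
noncomputable def gaussE (n : ℕ) : Measure (En n) :=
  volume.withDensity (fun x =>
    ENNReal.ofReal ((2 * Real.pi) ^ (-(n : ℝ) / 2) * Real.exp (-‖x‖ ^ 2 / 2)))

/-- Ornstein–Uhlenbeck semigroup `Q_t`. -/
noncomputable def ou (n : ℕ) (t : ℝ) (f : En n → ℝ) (x : En n) : ℝ :=
  ∫ y, f (Real.exp (-t) • x + Real.sqrt (1 - Real.exp (-2 * t)) • y) ∂(gaussE n)

open ProbabilityTheory Filter Topology

lemma gaussPdf_eq_gaussianPDFReal (x : ℝ) : gaussPdf x = gaussianPDFReal 0 1 x := by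
  simp [gaussPdf, gaussianPDFReal]

lemma gaussPdf_nonneg (x : ℝ) : 0 ≤ gaussPdf x := by
  unfold gaussPdf; positivity

lemma integrable_gaussPdf : Integrable gaussPdf := by
  simpa [funext gaussPdf_eq_gaussianPDFReal] using integrable_gaussianPDFReal 0 1

lemma setIntegral_gaussianReal (g : ℝ → ℝ) {s : Set ℝ} (hs : MeasurableSet s) :
    ∫ x in s, g x ∂(gaussianReal 0 1) = ∫ x in s, gaussPdf x * g x := by
  rw [← integral_indicator hs, ← integral_indicator hs,
    integral_gaussianReal_eq_integral_smul one_ne_zero]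
  congr 1 with x
  by_cases hx : x ∈ s <;> simp [hx, gaussPdf_eq_gaussianPDFReal]

lemma gaussCdf_eq_measureReal (q : ℝ) : gaussCdf q = (gaussianReal 0 1).real (Set.Iic q) := by
  have h := setIntegral_gaussianReal (fun _ => 1) (measurableSet_Iic (a := q))
  simpa [gaussCdf] using h.symm

lemma continuous_gaussCdf : Continuous gaussCdf := by
  have h : gaussCdf = fun x => gaussCdf 0 + ∫ t in (0 : ℝ)..x, gaussPdf t := by
    ext x
    have := intervalIntegral.integral_Iic_sub_Iic (f := gaussPdf) (μ := volume) (a := 0) (b := x)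
      integrable_gaussPdf.integrableOn integrable_gaussPdf.integrableOn
    rw [← this]; simp [gaussCdf]
  rw [h]
  exact continuous_const.add (intervalIntegral.continuous_primitive
    (fun a b => integrable_gaussPdf.intervalIntegrable) 0)

lemma gaussCdf_gaussQuantile {p : ℝ} (hp : p ∈ Set.Ioo (0 : ℝ) 1) :
    gaussCdf (gaussQuantile p) = p := by
  refine Function.invFun_eq (f := gaussCdf) ?_
  have hc : gaussCdf = fun x => cdf (gaussianReal 0 1) x := by
    ext x; rw [gaussCdf_eq_measureReal, cdf_eq_real]
  have h0 : Tendsto gaussCdf atBot (𝓝 0) := hc ▸ tendsto_cdf_atBot _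
  have h1 : Tendsto gaussCdf atTop (𝓝 1) := hc ▸ tendsto_cdf_atTop _
  exact mem_range_of_exists_le_of_exists_ge continuous_gaussCdf
    ((h0.eventually (ge_mem_nhds hp.1)).exists) ((h1.eventually (le_mem_nhds hp.2)).exists)

lemma integrable_id_gaussianReal : Integrable (fun x : ℝ => x) (gaussianReal 0 1) :=
  (memLp_id_gaussianReal (μ := 0) (v := 1) 1).integrable (by simp)

lemma integrable_affine_gaussianReal (m c : ℝ) :
    Integrable (fun s : ℝ => m - c * s) (gaussianReal 0 1) :=
  (integrable_const m).sub (integrable_id_gaussianReal.const_mul c)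

lemma setIntegral_Iic_id_gaussianReal (q : ℝ) :
    ∫ s in Set.Iic q, s ∂(gaussianReal 0 1) = -gaussPdf q := by
  rw [setIntegral_gaussianReal _ measurableSet_Iic]
  have hd : ∀ x ∈ Set.Iic q, HasDerivAt (fun x => -gaussPdf x) (gaussPdf x * x) x := by
    intro x _
    have h1 : HasDerivAt (fun x : ℝ => -(x ^ 2) / 2) (-x) x := by
      convert! ((hasDerivAt_pow 2 x).neg.div_const 2) using 1
      simp; ring
    convert! (h1.exp.const_mul (Real.sqrt (2 * Real.pi))⁻¹).neg using 1
    unfold gaussPdf; ring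
  have hint : Integrable (fun x => gaussPdf x * x) := by
    have h := integrable_id_gaussianReal
    rw [gaussianReal_of_var_ne_zero _ one_ne_zero,
      integrable_withDensity_iff_integrable_smul' (measurable_gaussianPDF _ _)
      (ae_of_all _ fun _ => gaussianPDF_lt_top)] at h
    simpa [toReal_gaussianPDF, gaussPdf_eq_gaussianPDFReal] using h
  have hlim : Tendsto (fun x => -gaussPdf x) atBot (𝓝 0) := by
    have h2 : Tendsto (fun x : ℝ => -(x ^ 2) / 2) atBot atBot := by
      have : Tendsto (fun x : ℝ => x ^ 2) atBot atTop :=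
        by
        simpa [Function.comp_def] using (tendsto_pow_atTop two_ne_zero).comp (tendsto_abs_atBot_atTop (G := ℝ))
      exact (tendsto_neg_atTop_atBot.comp this).atBot_div_const two_pos
    have := ((Real.tendsto_exp_atBot.comp h2).const_mul (Real.sqrt (2 * Real.pi))⁻¹).neg
    simpa [gaussPdf, Function.comp_def] using this
  rw [integral_Iic_of_hasDerivAt_of_tendsto' hd hint.integrableOn hlim, sub_zero]

lemma setIntegral_Iic_affine_gaussianReal (m c q : ℝ) :
    ∫ s in Set.Iic q, (m - c * s) ∂(gaussianReal 0 1) = m * gaussCdf q + c * gaussPdf q := by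
  rw [integral_sub (integrable_const m) (integrable_id_gaussianReal.const_mul c).integrableOn,
    integral_const_mul, setIntegral_Iic_id_gaussianReal, gaussCdf_eq_measureReal]
  simp; ring

lemma Igauss_nonneg (p : ℝ) : 0 ≤ Igauss p := by
  unfold Igauss
  split_ifs
  exacts [le_rfl, gaussPdf_nonneg _]

/-- The profile as a support function: `E (m - c S)₊` dominates `m p + c I_γ(p)`. -/
lemma mul_add_mul_Igauss_le (m c : ℝ) {p : ℝ} (hp : p ∈ Set.Icc (0 : ℝ) 1) :
    m * p + c * Igauss p ≤ ∫ s, max (m - c * s) 0 ∂(gaussianReal 0 1) := by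
  have hi := integrable_affine_gaussianReal m c
  have hpos : ∀ s, 0 ≤ max (m - c * s) 0 := fun s => le_max_right _ _
  rcases hp.1.eq_or_lt with rfl | h0
  · simpa [Igauss] using integral_nonneg hpos
  rcases hp.2.eq_or_lt with rfl | h1
  · have h := integral_mono hi hi.pos_part fun s => le_max_left (m - c * s) 0
    rw [integral_sub (integrable_const m) (integrable_id_gaussianReal.const_mul c),
      integral_const_mul, integral_id_gaussianReal] at h
    simpa [Igauss] using h
  · have hq := gaussCdf_gaussQuantile ⟨h0, h1⟩
    have hI : Igauss p = gaussPdf (gaussQuantile p) := by simp [Igauss, h0.ne', h1.ne]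
    rw [hI]
    nth_rw 1 [← hq]
    rw [← setIntegral_Iic_affine_gaussianReal]
    exact (integral_mono hi.integrableOn hi.pos_part.integrableOn fun s => le_max_left _ _).trans
      (setIntegral_le_integral hi.pos_part (ae_of_all _ hpos))

lemma integral_max_sub_gaussianReal (q : ℝ) :
    ∫ s, max (q - s) 0 ∂(gaussianReal 0 1) = q * gaussCdf q + gaussPdf q := by
  have h := setIntegral_Iic_affine_gaussianReal q 1 q
  rw [← integral_indicator measurableSet_Iic] at h
  rw [← one_mul (gaussPdf q), ← h]
  congr 1 with s
  by_cases hs : s ≤ q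
  · simp [hs]
  · simp [hs, (not_le.1 hs).le]

lemma integrable_gaussE_density (n : ℕ) :
    Integrable (fun x : En n => (2 * Real.pi) ^ (-(n : ℝ) / 2) * Real.exp (-‖x‖ ^ 2 / 2)) := by
  have h := GaussianFourier.integrable_cexp_neg_mul_sq_norm_add (V := En n)
    (b := (1 / 2 : ℂ)) (by norm_num) 0 0
  refine Integrable.const_mul ?_ _
  convert! h.norm using 2 with x
  rw [Complex.norm_exp]
  congr 1
  have : (-(1 / 2) * (‖x‖ : ℂ) ^ 2 + 0 * (inner ℝ (0 : En n) x : ℝ)) =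
      ((-‖x‖ ^ 2 / 2 : ℝ) : ℂ) := by
    push_cast; ring
  rw [this, Complex.ofReal_re]

lemma integral_gaussE {F : Type*} [NormedAddCommGroup F] [NormedSpace ℝ F] {n : ℕ} (g : En n → F) :
    ∫ x, g x ∂(gaussE n) =
      ∫ x, ((2 * Real.pi) ^ (-(n : ℝ) / 2) * Real.exp (-‖x‖ ^ 2 / 2)) • g x := by
  rw [gaussE, integral_withDensity_eq_integral_toReal_smul (by fun_prop) (by simp)]
  congr 1 with x
  rw [ENNReal.toReal_ofReal (by positivity)]

lemma integrable_gaussE_iff {n : ℕ} {g : En n → ℝ} :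
    Integrable g (gaussE n) ↔ Integrable fun x =>
      (2 * Real.pi) ^ (-(n : ℝ) / 2) * Real.exp (-‖x‖ ^ 2 / 2) * g x := by
  rw [gaussE, integrable_withDensity_iff_integrable_smul' (by fun_prop) (by simp)]
  refine integrable_congr (ae_of_all _ fun x => ?_)
  dsimp only
  rw [ENNReal.toReal_ofReal (by positivity), smul_eq_mul]

lemma gaussE_eq_stdGaussian (n : ℕ) : gaussE n = stdGaussian (En n) := by
  have : IsFiniteMeasure (gaussE n) :=
    isFiniteMeasure_withDensity_ofReal (integrable_gaussE_density n).2
  apply Measure.ext_of_charFun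
  ext t
  rw [charFun_stdGaussian, charFun_apply, integral_gaussE]
  have h := GaussianFourier.integral_cexp_neg_mul_sq_norm_add (V := En n)
    (b := (1 / 2 : ℂ)) (by norm_num) Complex.I t
  simp only [finrank_euclideanSpace, Fintype.card_fin] at h
  have h2 : (2 * Real.pi : ℂ) ^ (-(n : ℂ) / 2) * (Real.pi / (1 / 2) : ℂ) ^ (n / 2 : ℂ) = 1 := by
    rw [show (Real.pi / (1 / 2) : ℂ) = 2 * Real.pi by ring, ← Complex.cpow_add]
    · ring_nf; simp
    · simp [Real.pi_ne_zero]
  calc _ = ∫ v : En n, (2 * Real.pi : ℂ) ^ (-(n : ℂ) / 2) *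
        Complex.exp (-(1 / 2) * ‖v‖ ^ 2 + Complex.I * inner ℝ t v) := by
        congr 1 with x
        rw [Complex.exp_add, Complex.real_smul, real_inner_comm x t]
        push_cast
        rw [Complex.ofReal_cpow (by positivity)]
        push_cast
        rw [mul_assoc]
        congr 3 <;> ring
    _ = _ := by
        rw [integral_const_mul, h, ← mul_assoc, h2, one_mul]
        simp
        ring_nf

instance (n : ℕ) : IsProbabilityMeasure (gaussE n) := by
  rw [gaussE_eq_stdGaussian]; infer_instance

lemma integrable_inner_gaussE {n : ℕ} (a : En n) :
    Integrable (fun x => inner ℝ a x) (gaussE n) := by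
  rw [gaussE_eq_stdGaussian]
  exact IsGaussian.integrable_id.const_inner a

/-- Under `γₙ ⊗ γ₁`, a unit linear functional is standard normal. -/
lemma map_inner_sub_mul_gaussE_prod {n : ℕ} {a : En n} {c : ℝ} (h : ‖a‖ ^ 2 + c ^ 2 = 1) :
    ((gaussE n).prod (gaussianReal 0 1)).map (fun z => -(inner ℝ a z.1 - c * z.2)) =
      gaussianReal 0 1 := by
  have hm : Measurable (fun z : En n × ℝ => -(inner ℝ a z.1 - c * z.2)) := by fun_prop
  have := Measure.isProbabilityMeasure_map (μ := (gaussE n).prod (gaussianReal 0 1))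
    hm.aemeasurable
  apply Measure.ext_of_charFun
  ext t
  rw [charFun_apply_real, integral_map hm.aemeasurable (by fun_prop)]
  have key : ∀ z : En n × ℝ,
      Complex.exp (t * (-(inner ℝ a z.1 - c * z.2) : ℝ) * Complex.I) =
      Complex.exp (inner ℝ z.1 (-t • a) * Complex.I) *
        Complex.exp ((t * c : ℝ) * z.2 * Complex.I) := by
    intro z
    rw [← Complex.exp_add, inner_smul_right, real_inner_comm z.1 a]
    push_cast
    ring_nf
  simp_rw [key]
  rw [integral_prod_mul (fun x : En n => Complex.exp (inner ℝ x (-t • a) * Complex.I))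
    (fun s : ℝ => Complex.exp ((t * c : ℝ) * s * Complex.I)), ← charFun_apply,
    ← charFun_apply_real, gaussE_eq_stdGaussian, charFun_stdGaussian, charFun_gaussianReal,
    charFun_gaussianReal, ← Complex.exp_add, norm_smul]
  congr 1
  have hac : (‖a‖ : ℂ) ^ 2 + (c : ℂ) ^ 2 = 1 := mod_cast h
  have ht : ((‖-t‖ : ℝ) : ℂ) ^ 2 = (t : ℂ) ^ 2 := by
    norm_cast; simp
  push_cast
  rw [mul_pow, ht]
  simp
  linear_combination (-(t : ℂ) ^ 2 / 2) * hac

/-- Bathtub principle for the Gaussian measure. -/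
lemma integral_inner_mul_add_le {n : ℕ} {a : En n} {c : ℝ} (h : ‖a‖ ^ 2 + c ^ 2 = 1)
    (hc : 0 ≤ c) {f k : En n → ℝ} (hf : Continuous f) (h01 : ∀ x, f x ∈ Set.Icc (0 : ℝ) 1)
    (hk : Integrable k (gaussE n)) (hkI : ∀ x, k x ≤ Igauss (f x))
    (hv : ∫ x, f x ∂(gaussE n) ∈ Set.Ioo (0 : ℝ) 1) :
    ∫ x, inner ℝ a x * f x ∂(gaussE n) + c * ∫ x, k x ∂(gaussE n) ≤
      Igauss (∫ x, f x ∂(gaussE n)) := by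
  set v := ∫ x, f x ∂(gaussE n) with hvdef
  set q := gaussQuantile v with hq
  have hqv : gaussCdf q = v := gaussCdf_gaussQuantile hv
  have hI : Igauss v = gaussPdf q := by simp [Igauss, hv.1.ne', hv.2.ne, hq]
  have hbd : ∀ x, ‖f x‖ ≤ 1 := fun x => by
    rw [Real.norm_of_nonneg (h01 x).1]; exact (h01 x).2
  have hfi : Integrable f (gaussE n) :=
    Integrable.of_bound hf.aestronglyMeasurable 1 (ae_of_all _ hbd)
  have hlf : Integrable (fun x => inner ℝ a x * f x) (gaussE n) :=
    (integrable_inner_gaussE a).mul_bdd hf.aestronglyMeasurable (ae_of_all _ hbd)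
  have hW : Integrable (fun z : En n × ℝ => inner ℝ a z.1 + q - c * z.2)
      ((gaussE n).prod (gaussianReal 0 1)) :=
    (((integrable_inner_gaussE a).comp_fst _).add (integrable_const q)).sub
      ((integrable_id_gaussianReal.comp_snd _).const_mul c)
  have h1 : ∫ x, (inner ℝ a x * f x + q * f x + c * k x) ∂(gaussE n) ≤
      ∫ x, ∫ s, max (inner ℝ a x + q - c * s) 0 ∂(gaussianReal 0 1) ∂(gaussE n) := by
    refine integral_mono ((hlf.add (hfi.const_mul q)).add (hk.const_mul c))
      hW.pos_part.integral_prod_left fun x => ?_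
    have := mul_add_mul_Igauss_le (inner ℝ a x + q) c (h01 x)
    have := mul_le_mul_of_nonneg_left (hkI x) hc
    dsimp only
    linarith
  have h2 : ∫ x, ∫ s, max (inner ℝ a x + q - c * s) 0 ∂(gaussianReal 0 1) ∂(gaussE n) =
      q * v + gaussPdf q := by
    rw [← hqv, ← integral_max_sub_gaussianReal, ← map_inner_sub_mul_gaussE_prod h,
      integral_map (by fun_prop) (by fun_prop), map_inner_sub_mul_gaussE_prod h,
      integral_prod]
    · congr! 5
      ring
    · convert! hW.pos_part using 3
      ring
  rw [h2, integral_add (by exact hlf.add (hfi.const_mul q)) (hk.const_mul c),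
    integral_add hlf (hfi.const_mul q), integral_const_mul, integral_const_mul] at h1
  rw [hI]
  linarith

lemma hasFDerivAt_gaussE_density {n : ℕ} (x : En n) :
    HasFDerivAt (fun x : En n => (2 * Real.pi) ^ (-(n : ℝ) / 2) * Real.exp (-‖x‖ ^ 2 / 2))
      (-((2 * Real.pi) ^ (-(n : ℝ) / 2) * Real.exp (-‖x‖ ^ 2 / 2)) • innerSL ℝ x) x := by
  have h1 : HasFDerivAt (fun x : En n => -‖x‖ ^ 2 / 2) (-innerSL ℝ x) x := by
    have h0 := ((hasStrictFDerivAt_norm_sq x).hasFDerivAt.neg.mul_const (1 / 2 : ℝ))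
    convert! h0 using 1
    · ext y; simp; ring
    · ext y; simp
  convert! h1.exp.const_mul ((2 * Real.pi) ^ (-(n : ℝ) / 2)) using 1
  ext y; simp; ring

/-- Gaussian integration by parts. -/
lemma integral_fderiv_gaussE {n : ℕ} (a : En n) {f : En n → ℝ} (hf : ContDiff ℝ 1 f) {B M : ℝ}
    (hB : ∀ x, ‖f x‖ ≤ B) (hM : ∀ x, ‖fderiv ℝ f x‖ ≤ M) :
    ∫ x, fderiv ℝ f x a ∂(gaussE n) = ∫ x, inner ℝ a x * f x ∂(gaussE n) := by
  set G : En n → ℝ := fun x => (2 * Real.pi) ^ (-(n : ℝ) / 2) * Real.exp (-‖x‖ ^ 2 / 2) with hG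
  have hGd : ∀ x, fderiv ℝ G x a = -(G x * inner ℝ a x) := fun x => by
    rw [(hasFDerivAt_gaussE_density x).fderiv]
    simp [hG, real_inner_comm x a]
  have hfc : Continuous f := hf.continuous
  have hdc : Continuous fun x => fderiv ℝ f x a :=
    (hf.continuous_fderiv one_ne_zero).clm_apply continuous_const
  have hfi : Integrable f (gaussE n) :=
    Integrable.of_bound hfc.aestronglyMeasurable B (ae_of_all _ hB)
  have hdi : Integrable (fun x => fderiv ℝ f x a) (gaussE n) :=
    Integrable.of_bound hdc.aestronglyMeasurable (M * ‖a‖) (ae_of_all _ fun x =>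
      ((fderiv ℝ f x).le_opNorm a).trans (mul_le_mul_of_nonneg_right (hM x) (norm_nonneg a)))
  have hlf : Integrable (fun x => inner ℝ a x * f x) (gaussE n) :=
    (integrable_inner_gaussE a).mul_bdd hfc.aestronglyMeasurable (ae_of_all _ hB)
  rw [integrable_gaussE_iff] at hfi hdi hlf
  have h := integral_mul_fderiv_eq_neg_fderiv_mul_of_integrable (μ := volume) (f := f) (g := G)
    (v := a) (by simpa [hG, mul_comm] using hdi)
    (by simp_rw [hGd]; convert! hlf.neg using 2 with x; simp only [Pi.neg_apply, hG]; ring)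
    (by simpa [hG, mul_comm] using hfi)
    (fun x _ => hf.differentiable one_ne_zero x)
    (fun x _ => (hasFDerivAt_gaussE_density x).differentiableAt)
  rw [integral_gaussE, integral_gaussE]
  simp_rw [hGd] at h
  rw [← neg_inj, ← integral_neg, ← integral_neg]
  calc _ = -∫ x, fderiv ℝ f x a * G x := by
        rw [← integral_neg]; congr 1 with x; simp [hG, mul_comm]
    _ = _ := by
        rw [← h]; congr 1 with x; simp only [hG, smul_eq_mul]; ring

lemma continuous_eq_const_of_ae_gaussE {n : ℕ} {f : En n → ℝ} (hf : Continuous f) {r : ℝ}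
    (h : f =ᵐ[gaussE n] fun _ => r) : f = fun _ => r := by
  have hac : (volume : Measure (En n)) ≪ gaussE n :=
    withDensity_absolutelyContinuous' (by fun_prop) (ae_of_all _ fun x => by
      simp only [ne_eq, ENNReal.ofReal_eq_zero, not_le]; positivity)
  exact (Continuous.ae_eq_iff_eq volume hf continuous_const).1 (hac.ae_eq h)

/-- Reverse Bobkov inequality in Gaussian space. -/
theorem reverse_bobkov {n : ℕ} (f : En n → ℝ)
    (hf : ContDiff ℝ 1 f) (h01 : ∀ x, f x ∈ Set.Icc (0 : ℝ) 1)
    (M : ℝ) (hM : ∀ x, ‖fderiv ℝ f x‖ ≤ M) :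
    ‖∫ x, gradient f x ∂(gaussE n)‖ ^ 2 + (∫ x, Igauss (f x) ∂(gaussE n)) ^ 2 ≤
      (Igauss (∫ x, f x ∂(gaussE n))) ^ 2 := by
  have hbd : ∀ x, ‖f x‖ ≤ 1 := fun x => by
    rw [Real.norm_of_nonneg (h01 x).1]; exact (h01 x).2
  have hfi : Integrable f (gaussE n) :=
    Integrable.of_bound hf.continuous.aestronglyMeasurable 1 (ae_of_all _ hbd)
  have hconst : ∀ r : ℝ, f = (fun _ => r) → ‖∫ x, gradient f x ∂(gaussE n)‖ ^ 2 +
      (∫ x, Igauss (f x) ∂(gaussE n)) ^ 2 ≤ (Igauss (∫ x, f x ∂(gaussE n))) ^ 2 := by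
    rintro r rfl
    simp [gradient]
  have hv0 : 0 ≤ ∫ x, f x ∂(gaussE n) := integral_nonneg fun x => (h01 x).1
  have hv1 : 0 ≤ ∫ x, (1 - f x) ∂(gaussE n) := integral_nonneg fun x => sub_nonneg.2 (h01 x).2
  have hsub : ∫ x, (1 - f x) ∂(gaussE n) = 1 - ∫ x, f x ∂(gaussE n) := by
    rw [integral_sub (integrable_const 1) hfi]; simp
  rcases hv0.eq_or_lt with h0 | h0
  · exact hconst 0 (continuous_eq_const_of_ae_gaussE hf.continuous
      ((integral_eq_zero_iff_of_nonneg (fun x => (h01 x).1) hfi).1 h0.symm))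
  rcases hv1.eq_or_lt with h1 | h1
  · refine hconst 1 (continuous_eq_const_of_ae_gaussE hf.continuous ?_)
    filter_upwards [(integral_eq_zero_iff_of_nonneg (fun x => sub_nonneg.2 (h01 x).2)
      ((integrable_const 1).sub hfi)).1 h1.symm] with x hx
    simp only [Pi.zero_apply] at hx
    linarith
  have hv : ∫ x, f x ∂(gaussE n) ∈ Set.Ioo (0 : ℝ) 1 := ⟨h0, by linarith⟩
  obtain ⟨k, hk, hkI, hkint⟩ : ∃ k : En n → ℝ, Integrable k (gaussE n) ∧
      (∀ x, k x ≤ Igauss (f x)) ∧ ∫ x, k x ∂(gaussE n) = ∫ x, Igauss (f x) ∂(gaussE n) := by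
    by_cases hi : Integrable (fun x => Igauss (f x)) (gaussE n)
    · exact ⟨_, hi, fun _ => le_rfl, rfl⟩
    · exact ⟨fun _ => 0, integrable_zero _ _ _, fun _ => Igauss_nonneg _, by
        rw [integral_undef hi]; simp⟩
  have hgc : Continuous (gradient f) :=
    (InnerProductSpace.toDual ℝ (En n)).symm.continuous.comp (hf.continuous_fderiv one_ne_zero)
  have hgi : Integrable (gradient f) (gaussE n) :=
    Integrable.of_bound hgc.aestronglyMeasurable M (ae_of_all _ fun x => by
      simpa [gradient] using hM x)
  set b := ∫ x, gradient f x ∂(gaussE n) with hb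
  set K := ∫ x, Igauss (f x) ∂(gaussE n) with hK
  have hK0 : 0 ≤ K := integral_nonneg fun x => Igauss_nonneg _
  have hinner : ∀ a : En n, ∫ x, inner ℝ a x * f x ∂(gaussE n) = inner ℝ a b := fun a => by
    rw [hb, ← integral_inner hgi, ← integral_fderiv_gaussE a hf hbd hM]
    congr 1 with x
    rw [real_inner_comm, inner_gradient_left]
  set R := Real.sqrt (‖b‖ ^ 2 + K ^ 2) with hR
  have hR2 : R ^ 2 = ‖b‖ ^ 2 + K ^ 2 := Real.sq_sqrt (by positivity)
  rw [← hR2]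
  have hR0 : 0 ≤ R := Real.sqrt_nonneg _
  refine pow_le_pow_left₀ hR0 ?_ 2
  rcases hR0.eq_or_lt with h | hRpos
  · rw [← h]; exact Igauss_nonneg _
  have hunit : ‖R⁻¹ • b‖ ^ 2 + (R⁻¹ * K) ^ 2 = 1 := by
    rw [norm_smul, Real.norm_of_nonneg (inv_nonneg.2 hR0), mul_pow, mul_pow, ← mul_add, ← hR2]
    field_simp
  have hmain := integral_inner_mul_add_le hunit (by positivity) hf.continuous h01 hk hkI hv
  rw [hinner, hkint, real_inner_smul_left, real_inner_self_eq_norm_sq] at hmain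
  convert! hmain using 1
  rw [mul_assoc, ← mul_add, ← sq, ← hR2]
  field_simp
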